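/- (Scaled-service omnithermal theorem, discrete form.) Let β ∈ (0,1], let (S_n)_{n≥1} be service durations with S_n > 0 and (τ_n)_{n≥0} inter-arrival times with τ_n ≥ 0, and let U_0 ∈ ℝ^c be a workload vector. Define four processes in ℝ^c: U starts at U_0 and L starts at the zero vector, each evolving by Ũ_n = dec_{τ_n}(U_n), U_{n+1} = arr_{S_{n+1}}(Ũ_n) (and similarly for L); U^β starts at U_0 and L^β starts at the zero vector, each evolving by the same recursion but with service durations βS_{n+1} in place of S_{n+1}. Suppose that for every n such that L̃_n ≠ Ũ_n, the implication holds: if L̃_n(1) = Ũ_n(1) then Ũ_n(1) = 0. Then for every n ≥ 0, C(L^β_n, U^β_n) ≤ C(L_n, U_n) and C(L̃^β_n, Ũ^β_n) ≤ C(L̃_n, Ũ_n); in particular, the sandwiching processes for the faster-working system coalesce no later than those of the original system. -/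

import Mathlib

open scoped Classical

noncomputable section

/-- The `k`-th coordinate (0-based) of a vector in `ℝ^n`, defaulting to 0 out of range. -/
def coord {n : ℕ} (V : Fin n → ℝ) (k : ℕ) : ℝ :=
  if h : k < n then V ⟨k, h⟩ else 0

/-- A workload vector: coordinates nonnegative and in increasing order. -/
def IsWorkload {n : ℕ} (V : Fin n → ℝ) : Prop :=
  Monotone V ∧ ∀ i, 0 ≤ V i

/-- Add the service duration `S` to the minimal (first) coordinate. -/
def bump {n : ℕ} (S : ℝ) (V : Fin n → ℝ) : Fin n → ℝ :=
  fun i => if (i : ℕ) = 0 then V i + S else V i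

/-- The arrival step: increasing rearrangement of the vector obtained from `V`
by replacing its minimal coordinate `V(1)` by `V(1) + S`. -/
def arr {n : ℕ} (S : ℝ) (V : Fin n → ℝ) : Fin n → ℝ :=
  bump S V ∘ Tuple.sort (bump S V)

/-- The decay step: each coordinate decreases by `t`, truncated at 0. -/
def dec {n : ℕ} (t : ℝ) (V : Fin n → ℝ) : Fin n → ℝ :=
  fun i => max (V i - t) 0

/-- The Kiefer-Wolfowitz one-step update with service `S` and elapsed time `t`. -/
def step {n : ℕ} (S t : ℝ) (V : Fin n → ℝ) : Fin n → ℝ :=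
  dec t (arr S V)

/-- `kU S V` (1-based): the least `k ∈ {1,…,n−1}` with `V(1)+S ≤ V(k+1)`
(0-based: `coord V 0 + S ≤ coord V k`), and `n` if there is no such `k`. -/
def kU {n : ℕ} (S : ℝ) (V : Fin n → ℝ) : ℕ :=
  sInf ({k : ℕ | 1 ≤ k ∧ k < n ∧ coord V 0 + S ≤ coord V k} ∪ {n})

/-- `OrdDom V W` (i.e. `V ⊴ W`): each of the `c` busiest servers of `V ∈ ℝ^{c+m}`
has no more work than the corresponding server of `W ∈ ℝ^c`. -/
def OrdDom {c m : ℕ} (V : Fin (c + m) → ℝ) (W : Fin c → ℝ) : Prop :=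
  ∀ k : ℕ, k < c → coord V (k + m) ≤ coord W k

/-- The time-to-coalescence `C(L,U)`: equal to `U(n)` for
`n = max{k : L(k) ≠ U(k)}` when `L ≠ U`, and `0` when `L = U`. -/
def coalTime {n : ℕ} (L U : Fin n → ℝ) : ℝ :=
  if L = U then 0 else coord U (sSup {k : ℕ | k < n ∧ coord L k ≠ coord U k})

end

section SortedRearrangement

lemma comp_sort_mono {n : ℕ} {f g : Fin n → ℝ} (h : f ≤ g) :
    f ∘ Tuple.sort f ≤ g ∘ Tuple.sort g := by
  intro i
  obtain ⟨k, hk⟩ : ((Finset.Ici i).map (Tuple.sort f).toEmbedding ∩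
      (Finset.Iic i).map (Tuple.sort g).toEmbedding).Nonempty := by
    apply Finset.inter_nonempty_of_card_lt_card_add_card (Finset.subset_univ _)
      (Finset.subset_univ _)
    simp only [Finset.card_map, Fin.card_Ici, Fin.card_Iic, Finset.card_univ, Fintype.card_fin]
    omega
  simp only [Finset.mem_inter, Finset.mem_map, Finset.mem_Ici, Finset.mem_Iic,
    Equiv.coe_toEmbedding] at hk
  obtain ⟨⟨a, ha, rfl⟩, b, hb, hab⟩ := hk
  calc (f ∘ Tuple.sort f) i ≤ (f ∘ Tuple.sort f) a := Tuple.monotone_sort f ha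
    _ ≤ g (Tuple.sort f a) := h _
    _ = (g ∘ Tuple.sort g) b := by rw [Function.comp_apply, hab]
    _ ≤ (g ∘ Tuple.sort g) i := Tuple.monotone_sort g hb

end SortedRearrangement

section Workload

variable {n : ℕ}

lemma coord_of_lt (V : Fin n → ℝ) {k : ℕ} (hk : k < n) : coord V k = V ⟨k, hk⟩ :=
  dif_pos hk

lemma dec_nonneg (t : ℝ) (V : Fin n → ℝ) (i : Fin n) : 0 ≤ dec t V i :=
  le_max_right _ _

lemma dec_mono (t : ℝ) {V W : Fin n → ℝ} (h : V ≤ W) : dec t V ≤ dec t W :=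
  fun i => max_le_max (sub_le_sub_right (h i) t) le_rfl

lemma dec_zero {V : Fin n → ℝ} (h : ∀ i, 0 ≤ V i) : dec 0 V = V := by
  funext i
  simp [dec, h i]

lemma dec_dec (s : ℝ) {t : ℝ} (ht : 0 ≤ t) (V : Fin n → ℝ) :
    dec t (dec s V) = dec (s + t) V := by
  funext i
  simp only [dec]
  rcases max_cases (V i - s) 0 with h | h <;> rcases max_cases (V i - (s + t)) 0 with h' | h' <;>
    rcases max_cases (max (V i - s) 0 - t) 0 with h'' | h'' <;> linarith

lemma IsWorkload.dec {V : Fin n → ℝ} (h : IsWorkload V) (t : ℝ) : IsWorkload (dec t V) :=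
  ⟨fun _ _ hij => max_le_max (sub_le_sub_right (h.1 hij) t) le_rfl, dec_nonneg t V⟩

lemma bump_mono {S S' : ℝ} (hS : S ≤ S') {V W : Fin n → ℝ} (h : V ≤ W) :
    bump S V ≤ bump S' W := by
  intro i
  have := h i
  simp only [bump]
  split_ifs <;> linarith

lemma arr_mono {S S' : ℝ} (hS : S ≤ S') {V W : Fin n → ℝ} (h : V ≤ W) :
    arr S V ≤ arr S' W :=
  comp_sort_mono (bump_mono hS h)

lemma IsWorkload.arr {V : Fin n → ℝ} (h : IsWorkload V) {S : ℝ} (hS : 0 ≤ S) :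
    IsWorkload (arr S V) := by
  refine ⟨Tuple.monotone_sort _, fun i => ?_⟩
  have := h.2 (Tuple.sort (bump S V) i)
  simp only [_root_.arr, Function.comp_apply]
  generalize Tuple.sort (bump S V) i = j at this ⊢
  simp only [bump]
  split_ifs <;> linarith

lemma dec_arr (t S : ℝ) (V : Fin n → ℝ) :
    dec t (arr S V) = dec t (bump S V) ∘ Tuple.sort (bump S V) := rfl

lemma monotone_dec_arr (t S : ℝ) (V : Fin n → ℝ) : Monotone (dec t (arr S V)) :=
  fun _ _ hij => max_le_max (sub_le_sub_right (Tuple.monotone_sort (bump S V) hij) t) le_rfl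

lemma dec_arr_eq_iff {V W : Fin n → ℝ} (h : V ≤ W) (t S : ℝ) :
    dec t (arr S V) = dec t (arr S W) ↔ dec t (bump S V) = dec t (bump S W) := by
  constructor
  · intro he
    have hsum : ∑ i, dec t (bump S V) i = ∑ i, dec t (bump S W) i := by
      rw [← Equiv.sum_comp (Tuple.sort (bump S V)) (dec t (bump S V)),
        ← Equiv.sum_comp (Tuple.sort (bump S W)) (dec t (bump S W))]
      exact Finset.sum_congr rfl fun i _ => congrFun he i
    funext i
    exact (Finset.sum_eq_sum_iff_of_le
      fun i _ => dec_mono t (bump_mono le_rfl h) i).1 hsum i (Finset.mem_univ i)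
  · intro he
    have hV := monotone_dec_arr t S V
    have hW := monotone_dec_arr t S W
    rw [dec_arr] at hV hW
    rw [dec_arr, dec_arr]
    rw [he] at hV ⊢
    exact Tuple.unique_monotone hV hW

lemma dec_bump_eq_iff (hn : 0 < n) {V W : Fin n → ℝ} (h : V ≤ W) {S : ℝ} (hS : 0 ≤ S) (t : ℝ) :
    dec t (bump S V) = dec t (bump S W) ↔
      dec t V = dec t W ∧ (V ⟨0, hn⟩ = W ⟨0, hn⟩ ∨ W ⟨0, hn⟩ + S ≤ t) := by
  have h0 := h ⟨0, hn⟩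
  constructor
  · intro he
    have he0 : V ⟨0, hn⟩ = W ⟨0, hn⟩ ∨ W ⟨0, hn⟩ + S ≤ t := by
      have := congrFun he ⟨0, hn⟩
      simp only [dec, bump, if_true] at this
      by_contra! hne
      have hlt := lt_of_le_of_ne h0 hne.1
      rw [max_eq_left (by linarith [hne.2] : 0 ≤ W ⟨0, hn⟩ + S - t)] at this
      rcases max_cases (V ⟨0, hn⟩ + S - t) 0 with h' | h' <;> linarith [hne.2]
    refine ⟨funext fun i => ?_, he0⟩
    by_cases hi : (i : ℕ) = 0
    · obtain rfl : i = ⟨0, hn⟩ := Fin.ext hi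
      rcases he0 with he0 | he0
      · simp only [dec, he0]
      · simp only [dec]
        rw [max_eq_right (by linarith), max_eq_right (by linarith)]
    · simpa only [dec, bump, if_neg hi] using congrFun he i
  · rintro ⟨he, he0⟩
    funext i
    by_cases hi : (i : ℕ) = 0
    · obtain rfl : i = ⟨0, hn⟩ := Fin.ext hi
      simp only [dec, bump, if_true]
      rcases he0 with he0 | he0
      · rw [he0]
      · rw [max_eq_right (by linarith), max_eq_right (by linarith)]
    · simpa only [dec, bump, if_neg hi] using congrFun he i

lemma coalTime_nonneg (L : Fin n → ℝ) {U : Fin n → ℝ} (hU : ∀ i, 0 ≤ U i) :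
    0 ≤ coalTime L U := by
  unfold coalTime coord
  split_ifs
  · exact le_rfl
  · exact hU _
  · exact le_rfl

/-- The time-to-coalescence is the time needed for the two vectors to agree without arrivals. -/
lemma coalTime_le_iff {L U : Fin n → ℝ} (hU : Monotone U) (h : L ≤ U) {t : ℝ} (ht : 0 ≤ t) :
    coalTime L U ≤ t ↔ dec t L = dec t U := by
  by_cases he : L = U
  · simp [coalTime, he, ht]
  rw [coalTime, if_neg he]
  set A : Set ℕ := {k | k < n ∧ coord L k ≠ coord U k} with hA
  have hbdd : BddAbove A := ⟨n, fun k hk => hk.1.le⟩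
  have hne : A.Nonempty := by
    obtain ⟨i, hi⟩ := Function.ne_iff.1 he
    exact ⟨i, i.2, by rwa [coord_of_lt L i.2, coord_of_lt U i.2]⟩
  obtain ⟨hlt, hdiff⟩ := Nat.sSup_mem hne hbdd
  rw [coord_of_lt _ hlt, coord_of_lt _ hlt] at hdiff
  rw [coord_of_lt _ hlt]
  constructor
  · intro hle
    funext i
    by_cases hi : (i : ℕ) ≤ sSup A
    · have h1 : U i ≤ U ⟨sSup A, hlt⟩ := hU hi
      have h2 := h i
      simp only [dec]
      rw [max_eq_right (by linarith), max_eq_right (by linarith)]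
    · have hmem : (i : ℕ) ∉ A := notMem_of_csSup_lt (not_le.1 hi) hbdd
      have : L i = U i := by
        by_contra hc
        exact hmem ⟨i.2, by rwa [coord_of_lt L i.2, coord_of_lt U i.2]⟩
      simp only [dec, this]
  · intro hd
    have h1 := congrFun hd ⟨sSup A, hlt⟩
    have h2 := lt_of_le_of_ne (h _) hdiff
    simp only [dec] at h1
    by_contra! hc
    rw [max_eq_left (by linarith : 0 ≤ U ⟨sSup A, hlt⟩ - t)] at h1
    rcases max_cases (L ⟨sSup A, hlt⟩ - t) 0 with h' | h' <;> linarith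

lemma coalTime_le_coalTime {L U L' U' : Fin n → ℝ} (hU : IsWorkload U) (h : L ≤ U)
    (hU' : IsWorkload U') (h' : L' ≤ U')
    (himp : ∀ t, 0 ≤ t → dec t L = dec t U → dec t L' = dec t U') :
    coalTime L' U' ≤ coalTime L U := by
  have ht := coalTime_nonneg L hU.2
  exact (coalTime_le_iff hU'.1 h' ht).2 (himp _ ht ((coalTime_le_iff hU.1 h ht).1 le_rfl))

/-- The relation between the original pair `L ≤ U` and the faster pair `L' ≤ U'` that is
preserved by the dynamics. -/
structure FasterPair (L U L' U' : Fin n → ℝ) : Prop where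
  workload_L : IsWorkload L
  workload_U : IsWorkload U
  workload_L' : IsWorkload L'
  workload_U' : IsWorkload U'
  le : L ≤ U
  le' : L' ≤ U'
  upper_le : U' ≤ U
  coal : ∀ t, 0 ≤ t → dec t L = dec t U → dec t L' = dec t U'

namespace FasterPair

variable {L U L' U' : Fin n → ℝ}

lemma coalTime_le (h : FasterPair L U L' U') : coalTime L' U' ≤ coalTime L U :=
  coalTime_le_coalTime h.workload_U h.le h.workload_U' h.le' h.coal

lemma dec (h : FasterPair L U L' U') {s : ℝ} (hs : 0 ≤ s) :
    FasterPair (dec s L) (dec s U) (dec s L') (dec s U') where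
  workload_L := h.workload_L.dec s
  workload_U := h.workload_U.dec s
  workload_L' := h.workload_L'.dec s
  workload_U' := h.workload_U'.dec s
  le := dec_mono s h.le
  le' := dec_mono s h.le'
  upper_le := dec_mono s h.upper_le
  coal t ht := by
    simp only [dec_dec s ht]
    exact h.coal _ (add_nonneg hs ht)

lemma arr (h : FasterPair L U L' U') (hn : 0 < n) {S S' : ℝ} (hS' : 0 ≤ S') (hS : S' ≤ S)
    (hcond : L ≠ U → L ⟨0, hn⟩ = U ⟨0, hn⟩ → U ⟨0, hn⟩ = 0) :
    FasterPair (arr S L) (arr S U) (arr S' L') (arr S' U') where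
  workload_L := h.workload_L.arr (hS'.trans hS)
  workload_U := h.workload_U.arr (hS'.trans hS)
  workload_L' := h.workload_L'.arr hS'
  workload_U' := h.workload_U'.arr hS'
  le := arr_mono le_rfl h.le
  le' := arr_mono le_rfl h.le'
  upper_le := arr_mono hS h.upper_le
  coal t ht := by
    rw [dec_arr_eq_iff h.le, dec_arr_eq_iff h.le', dec_bump_eq_iff hn h.le (hS'.trans hS),
      dec_bump_eq_iff hn h.le' hS']
    rintro ⟨he, h0⟩
    refine ⟨h.coal t ht he, ?_⟩
    have hUU := h.upper_le ⟨0, hn⟩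
    rcases h0 with h0 | h0
    · left
      by_cases hLU : L = U
      · have := h.coal 0 le_rfl (by rw [hLU])
        rw [dec_zero h.workload_L'.2, dec_zero h.workload_U'.2] at this
        rw [this]
      · have hU0 := hcond hLU h0
        have h1 := h.workload_L'.2 ⟨0, hn⟩
        have h2 := h.le' ⟨0, hn⟩
        linarith
    · right
      linarith

end FasterPair

end Workload

/-- scaled-service omnithermal theorem, discrete form: under the stated
condition, the sandwiching processes for the faster-working system (service durations
`β * S n`) coalesce no later than those of the original system, both pre- and
post-arrival, for all `n`. -/
theorem stmt15 {c : ℕ} (hc : 1 ≤ c) (β : ℝ) (hβ0 : 0 < β) (hβ1 : β ≤ 1)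
    (S τ : ℕ → ℝ) (hS : ∀ n, 0 < S n) (hτ : ∀ n, 0 ≤ τ n)
    (U0 : Fin c → ℝ) (hU0 : IsWorkload U0)
    (U L Ub Lb : ℕ → Fin c → ℝ)
    (hU0eq : U 0 = U0)
    (hL0 : L 0 = fun _ => 0)
    (hUb0 : Ub 0 = U0)
    (hLb0 : Lb 0 = fun _ => 0)
    (hUrec : ∀ n, U (n + 1) = arr (S (n + 1)) (dec (τ n) (U n)))
    (hLrec : ∀ n, L (n + 1) = arr (S (n + 1)) (dec (τ n) (L n)))
    (hUbrec : ∀ n, Ub (n + 1) = arr (β * S (n + 1)) (dec (τ n) (Ub n)))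
    (hLbrec : ∀ n, Lb (n + 1) = arr (β * S (n + 1)) (dec (τ n) (Lb n)))
    (hcond : ∀ n, dec (τ n) (L n) ≠ dec (τ n) (U n) →
      coord (dec (τ n) (L n)) 0 = coord (dec (τ n) (U n)) 0 →
      coord (dec (τ n) (U n)) 0 = 0) :
    ∀ n, coalTime (Lb n) (Ub n) ≤ coalTime (L n) (U n) ∧
      coalTime (dec (τ n) (Lb n)) (dec (τ n) (Ub n)) ≤
        coalTime (dec (τ n) (L n)) (dec (τ n) (U n)) := by
  have hn : 0 < c := hc
  have key : ∀ n, FasterPair (L n) (U n) (Lb n) (Ub n) := by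
    intro n
    induction n with
    | zero =>
      have hz : IsWorkload (fun _ : Fin c => (0 : ℝ)) := ⟨monotone_const, fun _ => le_rfl⟩
      rw [hL0, hLb0, hU0eq, hUb0]
      exact ⟨hz, hU0, hz, hU0, hU0.2, hU0.2, le_rfl, fun _ _ h => h⟩
    | succ n ih =>
      rw [hLrec, hUrec, hLbrec, hUbrec]
      have hSn := hS (n + 1)
      refine (ih.dec (hτ n)).arr hn (by positivity) (by nlinarith) ?_
      simpa only [coord_of_lt _ hn] using hcond n
  exact fun n => ⟨(key n).coalTime_le, ((key n).dec (hτ n)).coalTime_le⟩
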